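/- Let N ≥ 2, let ρ be a positive semidefinite matrix on ℂ² ⊗ ℂ^N, and let α be real with -2N/(3N-1) ≤ α ≤ 1. Then the matrix Λ^{2×N}(ρ) := N·ε(ρ) + ∑_{m=0}^{N-1} ε(S_B^m · ρ · (S_B^m)†) + α·ρ is separable. -/

import Mathlib

open Matrix Kronecker
open scoped ComplexOrder

noncomputable section

/-- A Hermitian matrix on ℂ^M ⊗ ℂ^N is separable if it is a finite sum of Kronecker
products of positive semidefinite matrices. -/
def IsSeparableMat {M N : ℕ} (σ : Matrix (Fin M × Fin N) (Fin M × Fin N) ℂ) : Prop :=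
  ∃ (k : ℕ) (A : Fin k → Matrix (Fin M) (Fin M) ℂ) (B : Fin k → Matrix (Fin N) (Fin N) ℂ),
    (∀ i, (A i).PosSemidef) ∧ (∀ i, (B i).PosSemidef) ∧ σ = ∑ i, A i ⊗ₖ B i

/-- The pinching onto the diagonal in the standard basis. -/
def pinch {ι : Type*} [DecidableEq ι] (X : Matrix ι ι ℂ) : Matrix ι ι ℂ :=
  Matrix.diagonal (fun i => X i i)

/-- The cyclic shift unitary on ℂ^d : S|j⟩ = |j+1 mod d⟩. -/
def shift (d : ℕ) : Matrix (Fin d) (Fin d) ℂ :=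
  fun i j => if (i : ℕ) = ((j : ℕ) + 1) % d then 1 else 0

end

namespace IsSeparableMat

variable {M N : ℕ}

theorem of_fintype {κ : Type*} [Fintype κ] {A : κ → Matrix (Fin M) (Fin M) ℂ}
    {B : κ → Matrix (Fin N) (Fin N) ℂ} (hA : ∀ i, (A i).PosSemidef)
    (hB : ∀ i, (B i).PosSemidef) : IsSeparableMat (∑ i, A i ⊗ₖ B i) := by
  let e := (Fintype.equivFin κ).symm
  exact ⟨Fintype.card κ, A ∘ e, B ∘ e, fun i => hA _, fun i => hB _,
    (e.sum_comp fun i => A i ⊗ₖ B i).symm⟩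

theorem kronecker {A : Matrix (Fin M) (Fin M) ℂ} {B : Matrix (Fin N) (Fin N) ℂ}
    (hA : A.PosSemidef) (hB : B.PosSemidef) : IsSeparableMat (A ⊗ₖ B) :=
  ⟨1, fun _ => A, fun _ => B, fun _ => hA, fun _ => hB, by simp⟩

theorem sum {κ : Type*} [Fintype κ] {σ : κ → Matrix (Fin M × Fin N) (Fin M × Fin N) ℂ}
    (h : ∀ i, IsSeparableMat (σ i)) : IsSeparableMat (∑ i, σ i) := by
  choose k A B hA hB hσ using h
  have : ∑ i, σ i = ∑ p : Σ i, Fin (k i), A p.1 p.2 ⊗ₖ B p.1 p.2 := by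
    rw [Fintype.sum_sigma]
    exact Finset.sum_congr rfl fun i _ => hσ i
  rw [this]
  exact of_fintype (fun p => hA p.1 p.2) (fun p => hB p.1 p.2)

theorem add {σ τ : Matrix (Fin M × Fin N) (Fin M × Fin N) ℂ}
    (hσ : IsSeparableMat σ) (hτ : IsSeparableMat τ) : IsSeparableMat (σ + τ) := by
  have : IsSeparableMat (∑ i : Fin 2, ![σ, τ] i) :=
    IsSeparableMat.sum fun i => by fin_cases i <;> simpa
  simpa using this

theorem smul {σ : Matrix (Fin M × Fin N) (Fin M × Fin N) ℂ} (hσ : IsSeparableMat σ)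
    {c : ℝ} (hc : 0 ≤ c) : IsSeparableMat ((c : ℂ) • σ) := by
  obtain ⟨k, A, B, hA, hB, rfl⟩ := hσ
  refine ⟨k, fun i => (c : ℂ) • A i, B, fun i => (hA i).smul (by exact_mod_cast hc), hB, ?_⟩
  simp [Finset.smul_sum, smul_kronecker]

end IsSeparableMat

/-- The block matrix supported on the levels `j`, `l` of the second factor, with diagonal
blocks `P` and off-diagonal blocks `C`, `Cᴴ`. -/
def twoLevel {M N : ℕ} (j l : Fin N) (P C : Matrix (Fin M) (Fin M) ℂ) :
    Matrix (Fin M × Fin N) (Fin M × Fin N) ℂ :=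
  P ⊗ₖ (single j j 1 + single l l 1) + C ⊗ₖ single j l 1 + Cᴴ ⊗ₖ single l j 1

section twoLevel

variable {M N : ℕ} (j l : Fin N)

theorem twoLevel_add (P Q C D : Matrix (Fin M) (Fin M) ℂ) :
    twoLevel j l (P + Q) (C + D) = twoLevel j l P C + twoLevel j l Q D := by
  simp only [twoLevel, add_kronecker, conjTranspose_add]
  abel

theorem twoLevel_real_smul (r : ℝ) (P C : Matrix (Fin M) (Fin M) ℂ) :
    twoLevel j l ((r : ℂ) • P) ((r : ℂ) • C) = (r : ℂ) • twoLevel j l P C := by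
  simp [twoLevel, smul_kronecker, conjTranspose_smul]

theorem posSemidef_single_add_single {c : ℂ} (hc : ‖c‖ ≤ 1) :
    (single j j 1 + single l l 1 + c • single j l 1 + star c • single l j 1 :
      Matrix (Fin N) (Fin N) ℂ).PosSemidef := by
  have key : (single j j 1 + single l l 1 + c • single j l 1 + star c • single l j 1 :
      Matrix (Fin N) (Fin N) ℂ) =
      vecMulVec (Pi.single j 1 + star c • Pi.single l 1)
        (star (Pi.single j 1 + star c • Pi.single l 1)) +
      ((1 - ‖c‖ ^ 2 : ℝ) : ℂ) • vecMulVec (Pi.single l 1) (star (Pi.single l 1)) := by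
    have hcc : c * star c = ((‖c‖ ^ 2 : ℝ) : ℂ) := by
      simpa using Complex.mul_conj' c
    have h1 : ∀ x : Fin N, star (Pi.single x (1 : ℂ) : Fin N → ℂ) = Pi.single x 1 := by
      intro x; rw [← Pi.single_star]; simp
    have h2 : ∀ x y : Fin N, vecMulVec (Pi.single x (1 : ℂ)) (Pi.single y 1) = single x y 1 := by
      intro x y; simp [single_eq_single_vecMulVec_single]
    simp only [star_add, star_smul, h1, add_vecMulVec, vecMulVec_add, smul_vecMulVec,
      vecMulVec_smul, h2, star_star, smul_smul, smul_add, hcc]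
    push_cast
    module
  rw [key]
  refine (posSemidef_vecMulVec_self_star _).add ((posSemidef_vecMulVec_self_star _).smul ?_)
  have : (0 : ℝ) ≤ 1 - ‖c‖ ^ 2 := by nlinarith [norm_nonneg c]
  exact_mod_cast this

theorem isSeparableMat_twoLevel_smul {Q : Matrix (Fin M) (Fin M) ℂ} (hQ : Q.PosSemidef)
    {c : ℂ} (hc : ‖c‖ ≤ 1) : IsSeparableMat (twoLevel j l Q (c • Q)) := by
  have : twoLevel j l Q (c • Q) =
      Q ⊗ₖ (single j j 1 + single l l 1 + c • single j l 1 + star c • single l j 1) := by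
    simp only [twoLevel, conjTranspose_smul, hQ.isHermitian.eq, kronecker_add, smul_kronecker,
      kronecker_smul]
  rw [this]
  exact .kronecker hQ (posSemidef_single_add_single j l hc)

theorem exists_involution_of_traceless (g : ℝ) (q : ℂ) :
    ∃ H : Matrix (Fin 2) (Fin 2) ℂ, H.IsHermitian ∧ H * H = 1 ∧
      !![(g : ℂ), Complex.I * star q; -Complex.I * q, -g] =
        ((Real.sqrt (g ^ 2 + ‖q‖ ^ 2) : ℝ) : ℂ) • H := by
  set s := Real.sqrt (g ^ 2 + ‖q‖ ^ 2) with hs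
  have hs2 : s ^ 2 = g ^ 2 + ‖q‖ ^ 2 := Real.sq_sqrt (by positivity)
  have hqq : q * star q = ((‖q‖ ^ 2 : ℝ) : ℂ) := by simpa using Complex.mul_conj' q
  by_cases h0 : s = 0
  · have hg : g = 0 := by rw [h0] at hs2; nlinarith [sq_nonneg g, sq_nonneg ‖q‖]
    have hq : q = 0 := by
      rw [← norm_eq_zero]; rw [h0] at hs2; nlinarith [sq_nonneg g, sq_nonneg ‖q‖]
    refine ⟨1, isHermitian_one, by simp, ?_⟩
    ext i k; fin_cases i <;> fin_cases k <;> simp [h0, hg, hq]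
  · have hsC : (s : ℂ) ≠ 0 := by exact_mod_cast h0
    have hs2C : (s : ℂ) ^ 2 = g ^ 2 + q * star q := by rw [hqq]; exact_mod_cast hs2
    refine ⟨(s : ℂ)⁻¹ • !![(g : ℂ), Complex.I * star q; -Complex.I * q, -g], ?_, ?_, ?_⟩
    · ext i k; fin_cases i <;> fin_cases k <;> simp
    · have hsq : !![(g : ℂ), Complex.I * star q; -Complex.I * q, -g] *
          !![(g : ℂ), Complex.I * star q; -Complex.I * q, -g] = (s : ℂ) ^ 2 • 1 := by
        rw [hs2C]
        ext i k
        fin_cases i <;> fin_cases k <;> simp <;> ring_nf <;> simp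
      rw [smul_mul_smul_comm, hsq, smul_smul]
      field_simp
      simp
    · rw [smul_smul, mul_inv_cancel₀ hsC, one_smul]

theorem posSemidef_half_one_add {n : Type*} [Fintype n] [DecidableEq n] {H : Matrix n n ℂ}
    (hH : H.IsHermitian) (hH2 : H * H = 1) : ((2⁻¹ : ℂ) • (1 + H)).PosSemidef := by
  have : (2⁻¹ : ℂ) • (1 + H) = ((2⁻¹ : ℂ) • (1 + H))ᴴ * ((2⁻¹ : ℂ) • (1 + H)) := by
    simp only [conjTranspose_smul, conjTranspose_add, conjTranspose_one, hH.eq,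
      smul_mul_smul_comm, add_mul, mul_add, hH2, mul_one, one_mul]
    rw [show star (2⁻¹ : ℂ) = 2⁻¹ by simp]
    module
  rw [this]
  exact posSemidef_conjTranspose_mul_self _

/-- The off-diagonal block may be `L * V * Lᴴ` for `V` a real multiple of an `SU(2)` matrix with
norm at most one: `V` is diagonalized by the spectral projections `(1 ± H) / 2`. -/
theorem isSeparableMat_twoLevel_quaternion (L : Matrix (Fin M) (Fin 2) ℂ) {p q c : ℂ}
    (hpq : ‖p‖ ^ 2 + ‖q‖ ^ 2 ≤ 1) (hc : ‖c‖ ≤ 1) :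
    IsSeparableMat (twoLevel j l (L * Lᴴ) (c • (L * !![p, -star q; q, star p] * Lᴴ))) := by
  obtain ⟨H, hH, hH2, hs⟩ := exists_involution_of_traceless p.im q
  set s := Real.sqrt (p.im ^ 2 + ‖q‖ ^ 2) with hsdef
  have hs2 : s ^ 2 = p.im ^ 2 + ‖q‖ ^ 2 := Real.sq_sqrt (by positivity)
  have hp2 : ‖p‖ ^ 2 = p.re ^ 2 + p.im ^ 2 := by
    rw [Complex.sq_norm, Complex.normSq_apply]; ring
  have hV : !![p, -star q; q, star p] =
      (p.re : ℂ) • (1 : Matrix (Fin 2) (Fin 2) ℂ) + Complex.I • (s : ℂ) • H := by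
    rw [← hs]
    ext i k
    fin_cases i <;> fin_cases k <;> simp [← mul_assoc, Complex.ext_iff]
  have hQ : ∀ K : Matrix (Fin 2) (Fin 2) ℂ, K.IsHermitian → K * K = 1 →
      (L * ((2⁻¹ : ℂ) • (1 + K)) * Lᴴ).PosSemidef := fun K h1 h2 =>
    (posSemidef_half_one_add h1 h2).mul_mul_conjTranspose_same L
  have hn : ∀ t : ℝ, t ^ 2 = s ^ 2 → ‖c * (p.re + t * Complex.I)‖ ≤ 1 := by
    intro t ht
    have : ‖(p.re + t * Complex.I : ℂ)‖ ≤ 1 := by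
      rw [← sq_le_one_iff₀ (norm_nonneg _), Complex.sq_norm, Complex.normSq_add_mul_I]
      linarith
    rw [norm_mul]
    exact mul_le_one₀ hc (norm_nonneg _) this
  have h1 := isSeparableMat_twoLevel_smul j l (hQ H hH hH2) (hn s rfl)
  have h2 := isSeparableMat_twoLevel_smul j l (hQ (-H) hH.neg (by simpa using hH2))
    (hn (-s) (by ring))
  have := h1.add h2
  rw [← twoLevel_add] at this
  convert this using 2
  · rw [← Matrix.add_mul, ← Matrix.mul_add, ← smul_add]
    rw [show (2⁻¹ : ℂ) • ((1 + H) + (1 + -H)) = 1 by module, Matrix.mul_one]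
  · rw [hV]
    simp only [Matrix.mul_add, Matrix.add_mul, Matrix.mul_neg, Matrix.neg_mul, Matrix.mul_smul,
      Matrix.smul_mul, smul_add,
      smul_smul, smul_neg]
    push_cast
    module

theorem exists_normalized_pair (a c : ℂ) : ∃ (p : ℝ) (x y : ℂ), ‖x‖ ^ 2 + ‖y‖ ^ 2 = 1 ∧
    a = p * x ∧ c = p * y ∧ p ^ 2 = ‖a‖ ^ 2 + ‖c‖ ^ 2 := by
  set p := Real.sqrt (‖a‖ ^ 2 + ‖c‖ ^ 2) with hp
  have hp2 : p ^ 2 = ‖a‖ ^ 2 + ‖c‖ ^ 2 := Real.sq_sqrt (by positivity)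
  by_cases h0 : p = 0
  · rw [h0] at hp2
    have ha : a = 0 := by rw [← norm_eq_zero]; nlinarith [sq_nonneg ‖a‖, sq_nonneg ‖c‖]
    have hc : c = 0 := by rw [← norm_eq_zero]; nlinarith [sq_nonneg ‖a‖, sq_nonneg ‖c‖]
    exact ⟨0, 1, 0, by simp, by simp [ha], by simp [hc], by simp [ha, hc]⟩
  · have hpC : (p : ℂ) ≠ 0 := by exact_mod_cast h0
    refine ⟨p, a / p, c / p, ?_, by field_simp, by field_simp, hp2⟩
    simp only [norm_div, Complex.norm_real, Real.norm_eq_abs, div_pow, sq_abs]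
    field_simp
    exact hp2.symm

theorem isSeparableMat_twoLevel_vecMulVec (x y : Fin 2 → ℂ) {c : ℂ} (hc : ‖c‖ ≤ 1) :
    IsSeparableMat (twoLevel j l (diagonal fun i => x i * star (x i) + y i * star (y i))
      (c • vecMulVec x (star y))) := by
  obtain ⟨p, a, a', ha, hxa, hya, hp⟩ := exists_normalized_pair (x 0) (y 0)
  obtain ⟨q, b, b', hb, hxb, hyb, hq⟩ := exists_normalized_pair (x 1) (y 1)
  have hnorm : (‖a‖ ^ 2 + ‖b‖ ^ 2) * (‖a'‖ ^ 2 + ‖b'‖ ^ 2) ≤ 1 := by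
    nlinarith [sq_nonneg (‖a‖ ^ 2 + ‖b‖ ^ 2 - 1)]
  let L : Matrix (Fin 2) (Fin 2) ℂ := diagonal ![(p : ℂ), q]
  have hL : Lᴴ = L := by
    ext i k; fin_cases i <;> fin_cases k <;> simp [L]
  have hbound : ∀ ε : ℂ, ε = 1 ∨ ε = Complex.I →
      ‖ε * (a * star a') + star ε * (star b * b')‖ ^ 2 +
      ‖ε * (b * star a') - star ε * (star a * b')‖ ^ 2 ≤ 1 := by
    intro ε hε
    refine le_trans (le_of_eq ?_) hnorm
    simp only [Complex.sq_norm, Complex.normSq_apply]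
    rcases hε with rfl | rfl <;> simp <;> ring
  have hP : (diagonal fun i => x i * star (x i) + y i * star (y i)) = L * Lᴴ := by
    have hp' : ((p : ℂ)) ^ 2 = x 0 * star (x 0) + y 0 * star (y 0) := by
      have := congrArg (fun t : ℝ => (t : ℂ)) hp
      simpa [Complex.mul_conj'] using this
    have hq' : ((q : ℂ)) ^ 2 = x 1 * star (x 1) + y 1 * star (y 1) := by
      have := congrArg (fun t : ℝ => (t : ℂ)) hq
      simpa [Complex.mul_conj'] using this
    rw [hL]
    ext i k
    fin_cases i <;> fin_cases k <;> simp [L]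
    · simpa [sq] using hp'.symm
    · simpa [sq] using hq'.symm
  have h := ((isSeparableMat_twoLevel_quaternion j l L (hbound 1 (.inl rfl)) hc).add
    (isSeparableMat_twoLevel_quaternion j l L (c := -Complex.I * c) (hbound Complex.I (.inr rfl))
      (by simpa using hc))).smul (c := 2⁻¹) (by norm_num)
  rw [← twoLevel_add, ← twoLevel_real_smul] at h
  convert h using 2
  · rw [hP]
    push_cast
    module
  · rw [hL]
    ext i k
    fin_cases i <;> fin_cases k <;> simp [L, vecMulVec_apply, hxa, hxb, hya, hyb] <;> ring_nf <;>
      simp <;> ring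

end twoLevel

section shift

open scoped Fin.CommRing

theorem shift_apply {n : ℕ} (i j : Fin (n + 1)) :
    shift (n + 1) i j = if i = j + 1 then 1 else 0 := by
  simp [shift, Fin.ext_iff, Fin.val_add]

theorem shift_pow_apply {n : ℕ} (m : ℕ) (i j : Fin (n + 1)) :
    (shift (n + 1) ^ m) i j = if j = i - (m : Fin (n + 1)) then 1 else 0 := by
  induction m generalizing i j with
  | zero => simp [Matrix.one_apply, eq_comm]
  | succ m ih =>
    rw [pow_succ, Matrix.mul_apply]
    simp only [ih, shift_apply, ite_mul, one_mul, zero_mul, Finset.sum_ite_eq',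
      Finset.mem_univ, if_true]
    congr 1
    push_cast
    rw [sub_eq_iff_eq_add, eq_sub_iff_add_eq, add_comm (m : Fin (n + 1)), ← add_assoc]
    exact propext eq_comm

theorem one_kronecker_pow {n : ℕ} (S : Matrix (Fin n) (Fin n) ℂ) (m : ℕ) :
    ((1 : Matrix (Fin 2) (Fin 2) ℂ) ⊗ₖ S) ^ m = 1 ⊗ₖ (S ^ m) := by
  induction m with
  | zero => simp
  | succ m ih => rw [pow_succ, pow_succ, ih, ← mul_kronecker_mul, one_mul]

theorem one_kronecker_shift_pow_conj_apply_diag {n : ℕ}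
    (ρ : Matrix (Fin 2 × Fin (n + 1)) (Fin 2 × Fin (n + 1)) ℂ) (m : ℕ) (i : Fin 2)
    (j : Fin (n + 1)) :
    ((((1 : Matrix (Fin 2) (Fin 2) ℂ) ⊗ₖ shift (n + 1)) ^ m) * ρ *
      ((((1 : Matrix (Fin 2) (Fin 2) ℂ) ⊗ₖ shift (n + 1)) ^ m)ᴴ)) (i, j) (i, j) =
    ρ (i, j - m) (i, j - m) := by
  rw [one_kronecker_pow]
  simp [Matrix.mul_apply, Fintype.sum_prod_type, kroneckerMap_apply, shift_pow_apply,
    Matrix.one_apply, apply_ite]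

theorem sum_pinch_shift {n : ℕ}
    (ρ : Matrix (Fin 2 × Fin (n + 1)) (Fin 2 × Fin (n + 1)) ℂ) :
    ∑ m ∈ Finset.range (n + 1),
      pinch ((((1 : Matrix (Fin 2) (Fin 2) ℂ) ⊗ₖ shift (n + 1)) ^ m) * ρ *
        ((((1 : Matrix (Fin 2) (Fin 2) ℂ) ⊗ₖ shift (n + 1)) ^ m)ᴴ)) =
    diagonal fun x => ∑ k, ρ (x.1, k) (x.1, k) := by
  have : ∀ m : ℕ, pinch ((((1 : Matrix (Fin 2) (Fin 2) ℂ) ⊗ₖ shift (n + 1)) ^ m) * ρ *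
        ((((1 : Matrix (Fin 2) (Fin 2) ℂ) ⊗ₖ shift (n + 1)) ^ m)ᴴ)) =
      diagonal fun x => ρ (x.1, x.2 - (m : Fin (n + 1))) (x.1, x.2 - (m : Fin (n + 1))) := by
    intro m
    unfold pinch
    congr 1
    ext ⟨i, j⟩
    exact one_kronecker_shift_pow_conj_apply_diag ρ m i j
  simp only [this]
  ext x y
  rw [Matrix.sum_apply]
  by_cases h : x = y
  · subst h
    simp only [diagonal_apply_eq]
    rw [Finset.sum_range]
    simp only [Fin.cast_val_eq_self]
    exact (Equiv.subLeft x.2).sum_comp fun k => ρ (x.1, k) (x.1, k)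
  · simp [diagonal_apply_ne _ h]

end shift

theorem pinch_add_eq_sum_twoLevel {N : ℕ} (ψ : Fin 2 × Fin N → ℂ) (α : ℝ) :
    (N : ℂ) • pinch (vecMulVec ψ (star ψ)) +
      (diagonal fun x => ∑ k, vecMulVec ψ (star ψ) (x.1, k) (x.1, k)) +
      (α : ℂ) • vecMulVec ψ (star ψ) =
    ((2⁻¹ : ℝ) : ℂ) • ∑ j : Fin N, ∑ l : Fin N, twoLevel j l
      (diagonal fun i => ψ (i, j) * star (ψ (i, j)) + ψ (i, l) * star (ψ (i, l)))
      ((α : ℂ) • vecMulVec (fun i => ψ (i, j)) (star fun i => ψ (i, l))) := by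
  ext ⟨i, j⟩ ⟨k, l⟩
  simp only [twoLevel, pinch, Matrix.add_apply, Matrix.smul_apply, Matrix.sum_apply,
    kroneckerMap_apply, single_apply, diagonal_apply, vecMulVec_apply, conjTranspose_apply,
    Pi.star_apply, smul_eq_mul, Prod.mk.injEq]
  simp only [ite_and, mul_add, mul_ite, mul_one, mul_zero, Finset.sum_add_distrib]
  by_cases hik : i = k <;> by_cases hjl : j = l <;> simp [hik, hjl, Finset.sum_add_distrib] <;> ring

theorem stmt10 {N : ℕ} (hN : 2 ≤ N)
    (ρ : Matrix (Fin 2 × Fin N) (Fin 2 × Fin N) ℂ) (hρ : ρ.PosSemidef)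
    (α : ℝ) (hα1 : -(2 * (N : ℝ)) / (3 * (N : ℝ) - 1) ≤ α) (hα2 : α ≤ 1) :
    IsSeparableMat
      ((N : ℂ) • pinch ρ
        + ∑ m ∈ Finset.range N,
            pinch ((((1 : Matrix (Fin 2) (Fin 2) ℂ) ⊗ₖ shift N) ^ m) * ρ *
              ((((1 : Matrix (Fin 2) (Fin 2) ℂ) ⊗ₖ shift N) ^ m)ᴴ))
        + (α : ℂ) • ρ) := by
  obtain ⟨n, rfl⟩ : ∃ n, N = n + 1 := ⟨N - 1, by omega⟩
  have hα : ‖(α : ℂ)‖ ≤ 1 := by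
    rw [Complex.norm_real, Real.norm_eq_abs, abs_le]
    refine ⟨le_trans ?_ hα1, hα2⟩
    have h2 : (2 : ℝ) ≤ ((n + 1 : ℕ) : ℝ) := by exact_mod_cast hN
    rw [le_div_iff₀ (by linarith)]
    linarith
  rw [sum_pinch_shift]
  obtain ⟨m, ψ, hψ⟩ := posSemidef_iff_eq_sum_vecMulVec.mp hρ
  have key : ((n + 1 : ℕ) : ℂ) • pinch ρ + (diagonal fun x => ∑ k, ρ (x.1, k) (x.1, k)) +
      (α : ℂ) • ρ =
      ∑ s, (((n + 1 : ℕ) : ℂ) • pinch (vecMulVec (ψ s) (star (ψ s))) +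
        (diagonal fun x => ∑ k, vecMulVec (ψ s) (star (ψ s)) (x.1, k) (x.1, k)) +
        (α : ℂ) • vecMulVec (ψ s) (star (ψ s))) := by
    rw [hψ]
    ext x y
    by_cases h : x = y
    · subst h
      simp only [Matrix.add_apply, Matrix.smul_apply, pinch, diagonal_apply_eq, Matrix.sum_apply,
        Finset.sum_add_distrib, Finset.smul_sum]
      rw [Finset.sum_comm (s := (Finset.univ : Finset (Fin (n + 1))))]
    · simp [pinch, diagonal_apply_ne _ h, Matrix.sum_apply, Finset.mul_sum]
  rw [key]
  refine .sum fun s => ?_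
  rw [pinch_add_eq_sum_twoLevel]
  exact .smul (.sum fun j => .sum fun l => isSeparableMat_twoLevel_vecMulVec j l _ _ hα)
    (by norm_num)
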